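/- (Loewner optimality of the thresholds τ_n = a_nᵀh.) Let σ > 0, let d, N ≥ 1 be integers, let a_1,…,a_N ∈ ℝ^d, and fix h ∈ ℝ^d. Then for every choice of thresholds τ_1,…,τ_N ∈ ℝ, the d×d matrix Σ_{n=1}^{N} ( 2/(πσ²) − g_σ(a_nᵀh − τ_n) ) · a_n a_nᵀ is positive semidefinite; equivalently, Σ_{n=1}^{N} g_σ(a_nᵀh − τ_n^⋆) · a_n a_nᵀ − Σ_{n=1}^{N} g_σ(a_nᵀh − τ_n) · a_n a_nᵀ ⪰ 0 where τ_n^⋆ := a_nᵀh. -/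

import Mathlib

/-- PDF of a real Gaussian with mean 0 and variance σ². -/
noncomputable def gaussPhi (σ t : ℝ) : ℝ :=
  (Real.sqrt (2 * Real.pi * σ ^ 2))⁻¹ * Real.exp (-(t ^ 2) / (2 * σ ^ 2))

/-- CDF of a real Gaussian with mean 0 and variance σ². -/
noncomputable def gaussPhiCDF (σ t : ℝ) : ℝ := ∫ u in Set.Iic t, gaussPhi σ u

/-- g_σ(t) := φ_σ(t)² / (Φ_σ(t)·(1 − Φ_σ(t))). -/
noncomputable def gFun (σ t : ℝ) : ℝ :=
  (gaussPhi σ t) ^ 2 / (gaussPhiCDF σ t * (1 - gaussPhiCDF σ t))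

open Real MeasureTheory Set

lemma gaussPhi_eq_gaussianPDFReal (σ : ℝ) :
    gaussPhi σ = ProbabilityTheory.gaussianPDFReal 0 ⟨σ ^ 2, sq_nonneg σ⟩ := by
  ext t
  simp only [gaussPhi, ProbabilityTheory.gaussianPDFReal, sub_zero]
  rfl

lemma gaussPhi_nonneg (σ t : ℝ) : 0 ≤ gaussPhi σ t := by
  unfold gaussPhi; positivity

lemma gaussPhi_neg (σ t : ℝ) : gaussPhi σ (-t) = gaussPhi σ t := by
  simp [gaussPhi]

lemma integrable_gaussPhi (σ : ℝ) : Integrable (gaussPhi σ) := by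
  rw [gaussPhi_eq_gaussianPDFReal]
  exact ProbabilityTheory.integrable_gaussianPDFReal _ _

lemma integral_gaussPhi {σ : ℝ} (hσ : 0 < σ) : ∫ t, gaussPhi σ t = 1 := by
  rw [gaussPhi_eq_gaussianPDFReal]
  refine ProbabilityTheory.integral_gaussianPDFReal_eq_one _ fun h => ?_
  exact (pow_pos hσ 2).ne' (congrArg NNReal.toReal h)

lemma gaussPhiCDF_neg {σ : ℝ} (hσ : 0 < σ) (t : ℝ) :
    gaussPhiCDF σ (-t) = 1 - gaussPhiCDF σ t := by
  have h1 : gaussPhiCDF σ (-t) = ∫ u in Ioi t, gaussPhi σ u := by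
    have := integral_comp_neg_Iic (-t) (gaussPhi σ)
    simpa [gaussPhi_neg, gaussPhiCDF] using this
  have h2 := intervalIntegral.integral_Iic_add_Ioi (b := t)
    (integrable_gaussPhi σ).integrableOn (integrable_gaussPhi σ).integrableOn
  rw [integral_gaussPhi hσ] at h2
  rw [h1, gaussPhiCDF]
  linarith

lemma gaussPhi_mul_gaussPhi (σ x y : ℝ) :
    gaussPhi σ x * gaussPhi σ y =
      (2 * π * σ ^ 2)⁻¹ * exp (-(x ^ 2 + y ^ 2) / (2 * σ ^ 2)) := by
  have h : √(2 * π * σ ^ 2) * √(2 * π * σ ^ 2) = 2 * π * σ ^ 2 :=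
    mul_self_sqrt (by positivity)
  rw [gaussPhi, gaussPhi, mul_mul_mul_comm, ← mul_inv, h, ← exp_add]
  congr 2
  ring

lemma integral_mul_exp_neg_sq {σ : ℝ} (hσ : 0 < σ) (R : ℝ) :
    ∫ r in (0 : ℝ)..R, r * exp (-(r ^ 2) / (2 * σ ^ 2)) =
      σ ^ 2 * (1 - exp (-(R ^ 2) / (2 * σ ^ 2))) := by
  have hd : ∀ r ∈ uIcc 0 R, HasDerivAt (fun r => -σ ^ 2 * exp (-(r ^ 2) / (2 * σ ^ 2)))
      (r * exp (-(r ^ 2) / (2 * σ ^ 2))) r := by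
    intro r _
    have h := ((((hasDerivAt_pow 2 r).neg).div_const (2 * σ ^ 2)).exp).const_mul (-σ ^ 2)
    refine h.congr_deriv ?_
    simp only [Pi.neg_apply]
    field_simp
    norm_num [mul_comm]
  rw [intervalIntegral.integral_eq_sub_of_hasDerivAt hd
    (Continuous.intervalIntegrable (by fun_prop) _ _)]
  simp
  ring

/-- The mass that a centred isotropic planar Gaussian gives to a disc. -/
lemma setIntegral_disc_gaussPhi_mul_gaussPhi {σ : ℝ} (hσ : 0 < σ) {R : ℝ} (hR : 0 ≤ R) :
    ∫ p in {p : ℝ × ℝ | p.1 ^ 2 + p.2 ^ 2 ≤ R ^ 2}, gaussPhi σ p.1 * gaussPhi σ p.2 =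
      1 - exp (-(R ^ 2) / (2 * σ ^ 2)) := by
  have hm : MeasurableSet {p : ℝ × ℝ | p.1 ^ 2 + p.2 ^ 2 ≤ R ^ 2} :=
    measurableSet_le (by fun_prop) (by fun_prop)
  rw [← integral_indicator hm, ← integral_comp_polarCoord_symm]
  have key : ∀ p ∈ polarCoord.target,
      p.1 • indicator {p : ℝ × ℝ | p.1 ^ 2 + p.2 ^ 2 ≤ R ^ 2}
        (fun p => gaussPhi σ p.1 * gaussPhi σ p.2) (polarCoord.symm p) =
      (Iic R).indicator (fun r => r * exp (-(r ^ 2) / (2 * σ ^ 2))) p.1 *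
        (2 * π * σ ^ 2)⁻¹ := by
    rintro ⟨r, θ⟩ hp
    have hr : 0 < r := by simpa using hp.1
    have hsq : (r * cos θ) ^ 2 + (r * sin θ) ^ 2 = r ^ 2 := by
      linear_combination r ^ 2 * sin_sq_add_cos_sq θ
    by_cases h : r ≤ R
    · have h' : r ^ 2 ≤ R ^ 2 := by gcongr
      simp only [polarCoord_symm_apply, indicator, mem_ofPred_eq, mem_Iic, hsq, h, h', if_true,
        gaussPhi_mul_gaussPhi, smul_eq_mul]
      ring
    · have h' : ¬ r ^ 2 ≤ R ^ 2 := by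
        rwa [sq_le_sq₀ hr.le hR]
      simp only [polarCoord_symm_apply, indicator, mem_ofPred_eq, mem_Iic, hsq, h, h', if_false,
        smul_zero, zero_mul]
  rw [setIntegral_congr_fun polarCoord.open_target.measurableSet key]
  rw [polarCoord_target, Measure.volume_eq_prod,
    setIntegral_prod_mul ((Iic R).indicator fun r => r * exp (-(r ^ 2) / (2 * σ ^ 2)))
      (fun _ => (2 * π * σ ^ 2)⁻¹),
    setIntegral_indicator measurableSet_Iic, Ioi_inter_Iic,
    ← intervalIntegral.integral_of_le hR, integral_mul_exp_neg_sq hσ]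
  have hπ := pi_pos
  simp [pi_pos.le]
  field_simp
  ring

lemma sq_setIntegral_Icc_gaussPhi_le {σ : ℝ} (hσ : 0 < σ) {t : ℝ} (ht : 0 ≤ t) :
    (∫ u in Icc (-t) t, gaussPhi σ u) ^ 2 ≤ 1 - exp (-(t ^ 2) / σ ^ 2) := by
  have hint : Integrable (fun p : ℝ × ℝ => gaussPhi σ p.1 * gaussPhi σ p.2) :=
    (integrable_gaussPhi σ).mul_prod (integrable_gaussPhi σ)
  have hsub : Icc (-t) t ×ˢ Icc (-t) t ⊆ {p : ℝ × ℝ | p.1 ^ 2 + p.2 ^ 2 ≤ (√2 * t) ^ 2} := by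
    rintro ⟨x, y⟩ ⟨hx, hy⟩
    have hx' := sq_le_sq' hx.1 hx.2
    have hy' := sq_le_sq' hy.1 hy.2
    simp only [mem_ofPred_eq, mul_pow, sq_sqrt zero_le_two] at *
    linarith
  calc (∫ u in Icc (-t) t, gaussPhi σ u) ^ 2
      = ∫ p in Icc (-t) t ×ˢ Icc (-t) t, gaussPhi σ p.1 * gaussPhi σ p.2 := by
        rw [Measure.volume_eq_prod, setIntegral_prod_mul, sq]
    _ ≤ ∫ p in {p : ℝ × ℝ | p.1 ^ 2 + p.2 ^ 2 ≤ (√2 * t) ^ 2},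
          gaussPhi σ p.1 * gaussPhi σ p.2 :=
        setIntegral_mono_set hint.integrableOn
          (.of_forall fun p => mul_nonneg (gaussPhi_nonneg _ _) (gaussPhi_nonneg _ _))
          hsub.eventuallyLE
    _ = 1 - exp (-(t ^ 2) / σ ^ 2) := by
        rw [setIntegral_disc_gaussPhi_mul_gaussPhi hσ (by positivity), mul_pow,
          sq_sqrt zero_le_two]
        congr 2
        field_simp

lemma exp_neg_sq_le_four_mul_gaussPhiCDF {σ : ℝ} (hσ : 0 < σ) (t : ℝ) :
    exp (-(t ^ 2) / σ ^ 2) ≤ 4 * (gaussPhiCDF σ t * (1 - gaussPhiCDF σ t)) := by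
  wlog ht : 0 ≤ t generalizing t
  · have := this (-t) (by linarith)
    rw [gaussPhiCDF_neg hσ, neg_sq] at this
    linarith
  have hdiff : gaussPhiCDF σ t - gaussPhiCDF σ (-t) = ∫ u in Icc (-t) t, gaussPhi σ u := by
    rw [gaussPhiCDF, gaussPhiCDF, intervalIntegral.integral_Iic_sub_Iic
      (integrable_gaussPhi σ).integrableOn (integrable_gaussPhi σ).integrableOn,
      intervalIntegral.integral_of_le (by linarith), integral_Icc_eq_integral_Ioc]
  have h := sq_setIntegral_Icc_gaussPhi_le hσ ht
  rw [← hdiff, gaussPhiCDF_neg hσ] at h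
  linarith

lemma gFun_le {σ : ℝ} (hσ : 0 < σ) (t : ℝ) : gFun σ t ≤ 2 / (π * σ ^ 2) := by
  have h := exp_neg_sq_le_four_mul_gaussPhiCDF hσ t
  have hpos : 0 < gaussPhiCDF σ t * (1 - gaussPhiCDF σ t) := by
    linarith [exp_pos (-(t ^ 2) / σ ^ 2)]
  rw [gFun, div_le_iff₀ hpos, sq, gaussPhi_mul_gaussPhi]
  have he : -(t ^ 2 + t ^ 2) / (2 * σ ^ 2) = -(t ^ 2) / σ ^ 2 := by
    field_simp
    ring
  rw [he]
  calc (2 * π * σ ^ 2)⁻¹ * exp (-(t ^ 2) / σ ^ 2)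
      ≤ (2 * π * σ ^ 2)⁻¹ * (4 * (gaussPhiCDF σ t * (1 - gaussPhiCDF σ t))) := by gcongr
    _ = 2 / (π * σ ^ 2) * (gaussPhiCDF σ t * (1 - gaussPhiCDF σ t)) := by
        field_simp
        ring

lemma gFun_zero {σ : ℝ} (hσ : 0 < σ) : gFun σ 0 = 2 / (π * σ ^ 2) := by
  have h : gaussPhiCDF σ 0 = 1 / 2 := by
    have := gaussPhiCDF_neg hσ 0
    rw [neg_zero] at this
    linarith
  rw [gFun, h, sq, gaussPhi_mul_gaussPhi]
  have hπ := pi_pos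
  simp
  field_simp
  norm_num

/-- Loewner optimality of the thresholds τₙ = aₙᵀh: the matrix
Σₙ (2/(πσ²) − g_σ(aₙᵀh − τₙ))·aₙaₙᵀ is positive semidefinite; equivalently, the Fisher
information matrix at the optimal thresholds τₙ⋆ = aₙᵀh dominates the one at any
thresholds τₙ in the Loewner order. -/
theorem optimal_threshold_loewner (σ : ℝ) (hσ : 0 < σ) (d N : ℕ) (hd : 1 ≤ d) (hN : 1 ≤ N)
    (a : Fin N → Fin d → ℝ) (h : Fin d → ℝ) (τ : Fin N → ℝ) :
    (∑ n, (2 / (Real.pi * σ ^ 2) - gFun σ (∑ k, a n k * h k - τ n)) •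
        Matrix.vecMulVec (a n) (a n)).PosSemidef ∧
    (∑ n, gFun σ (∑ k, a n k * h k - (∑ k, a n k * h k)) • Matrix.vecMulVec (a n) (a n) -
      ∑ n, gFun σ (∑ k, a n k * h k - τ n) • Matrix.vecMulVec (a n) (a n)).PosSemidef := by
  have hpsd : (∑ n, (2 / (Real.pi * σ ^ 2) - gFun σ (∑ k, a n k * h k - τ n)) •
      Matrix.vecMulVec (a n) (a n)).PosSemidef :=
    Matrix.posSemidef_sum _ fun n _ =>
      (Matrix.posSemidef_vecMulVec_self_star (a n)).smul (sub_nonneg.2 (gFun_le hσ _))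
  refine ⟨hpsd, ?_⟩
  simpa only [sub_self, gFun_zero hσ, ← Finset.sum_sub_distrib, ← sub_smul] using hpsd
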